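/- Let K be a field and let u be algebraically independent indeterminates {u_{ik} : 0 ≤ i ≤ n, 1 ≤ k ≤ l_i} over K, and let η₁,…,ηₙ be further algebraically independent elements over K(u). Fix elements a_{ik} ∈ K(η₁,…,ηₙ)* (nonzero rational functions in the η's) and set ζ_i = −Σ_{k=1}^{l_i} u_{ik} a_{ik} for i = 0,…,n. Then trdeg K(u)(ζ₀,…,ζₙ)/K(u) ≥ r if and only if there exist distinct indices i₁,…,i_r and choices j₁,…,j_r (1 ≤ j_s ≤ l_{i_s}) such that a_{i₁ j₁},…,a_{i_r j_r} are algebraically independent over K. In particular, trdeg K(ζ₀,…,ζₙ, u)/K = Σ_i l_i + n if and only if there exist pairs (i_k, j_k), k = 1,…,n, with distinct i_k, such that a_{i₁j₁},…,a_{i_nj_n} are algebraically independent over K. -/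

import Mathlib

/-- The transcendence degree of a field extension `F/K`: the supremum of the
cardinalities of algebraically independent subsets of `F` over `K`. -/
noncomputable def fieldTrdeg (K F : Type*) [Field K] [Field F] [Algebra K F] : Cardinal :=
  ⨆ s : {s : Set F // AlgebraicIndependent K ((↑) : s → F)}, Cardinal.mk s.1

open IntermediateField in
/-- Translating an algebraically independent family by constants extends to an embedding of the
field it generates. -/
theorem AlgebraicIndependent.exists_algHom_translate {ι K Ω : Type*} [Field K] [Field Ω]
    [Algebra K Ω] {x : ι → Ω} (hx : AlgebraicIndependent K x) (c : ι → K) :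
    ∃ φ : adjoin K (Set.range x) →ₐ[K] Ω,
      ∀ i, φ ⟨x i, subset_adjoin K _ ⟨i, rfl⟩⟩ = x i + algebraMap K Ω (c i) := by
  have hy : AlgebraicIndependent K fun i ↦ x i + algebraMap K Ω (c i) := by
    have := hx.polynomial_aeval_of_transcendental
      (f := fun i ↦ Polynomial.X + Polynomial.C (c i)) fun i ↦ by
        exact Polynomial.transcendental _ (by simp) (by simp)
    simpa using this
  refine ⟨(val _).comp (hy.aevalEquivField.toAlgHom.comp hx.aevalEquivField.symm.toAlgHom),
    fun i ↦ ?_⟩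
  have h : hx.aevalEquivField.symm ⟨x i, subset_adjoin K _ ⟨i, rfl⟩⟩ =
      algebraMap (MvPolynomial ι K) (FractionRing (MvPolynomial ι K)) (MvPolynomial.X i) := by
    rw [AlgEquiv.symm_apply_eq]
    ext
    rw [hx.aevalEquivField_algebraMap_apply_coe, MvPolynomial.aeval_X]
  change (hy.aevalEquivField (hx.aevalEquivField.symm _) : Ω) = _
  rw [h, hy.aevalEquivField_algebraMap_apply_coe, MvPolynomial.aeval_X]

open IntermediateField in
/-- An embedding that maps the generators of `K(S)` into `K(S)` preserves algebraicity
over `K(S)`. -/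
theorem IsAlgebraic.algHom_of_mapsTo_adjoin {K Ω : Type*} [Field K] [Field Ω] [Algebra K Ω]
    {N : IntermediateField K Ω} (φ : N →ₐ[K] Ω) {S : Set Ω}
    (hS : ∀ s ∈ S, ∃ h : s ∈ N, φ ⟨s, h⟩ ∈ adjoin K S) {z : N}
    (hz : IsAlgebraic (adjoin K S) (z : Ω)) : IsAlgebraic (adjoin K S) (φ z) := by
  have hle : adjoin K S ≤ N := adjoin_le_iff.mpr fun s hs ↦ (hS s hs).1
  have hmap : ∀ m : adjoin K S, φ (inclusion hle m) ∈ adjoin K S := by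
    have : adjoin K S ≤ ((adjoin K S).comap φ).map N.val :=
      adjoin_le_iff.mpr fun s hs ↦ ⟨⟨s, (hS s hs).1⟩, (hS s hs).2, rfl⟩
    intro m
    obtain ⟨y, hy, hym⟩ := this m.2
    have : inclusion hle m = y := Subtype.ext hym.symm
    rw [this]
    exact hy
  let _ : Algebra (adjoin K S) N := (inclusion hle).toAlgebra
  have : IsScalarTower (adjoin K S) N Ω := .of_algebraMap_eq fun _ ↦ rfl
  have hz' : IsAlgebraic (adjoin K S) z :=
    (isAlgebraic_algebraMap_iff (algebraMap N Ω).injective).mp hz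
  let f : adjoin K S →+* adjoin K S :=
    ((φ.comp (inclusion hle)).toRingHom).codRestrict (adjoin K S) hmap
  exact hz'.ringHom_of_comp_eq f φ f.injective rfl

open IntermediateField in
/-- If a generic linear combination `∑ k, u k * a k` is algebraic over a field that contains the
`u k` and whose other generators do not involve them, then so is each `a k`. -/
theorem isAlgebraic_of_isAlgebraic_generic_combination {K Ω I H : Type*} {κ : I → Type*} [Field K]
    [Field Ω] [Algebra K Ω] [∀ i, Fintype (κ i)] {u : (Σ i, κ i) → Ω} {η : H → Ω}
    (hind : AlgebraicIndependent K (Sum.elim u η)) {a : (i : I) → κ i → Ω}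
    (ha : ∀ i k, a i k ∈ adjoin K (Set.range η)) {ζ : I → Ω}
    (hζ : ∀ i, ζ i = -∑ k, u ⟨i, k⟩ * a i k) {S : Set Ω} (huS : Set.range u ⊆ S) (i : I)
    (hS : ∀ s ∈ S, s ∈ Set.range u ∨ s ∈ adjoin K (Set.range η) ∨ ∃ j, j ≠ i ∧ s = ζ j)
    (halg : IsAlgebraic (adjoin K S) (ζ i)) (k : κ i) : IsAlgebraic (adjoin K S) (a i k) := by
  classical
  let c : (Σ i, κ i) → K := Pi.single ⟨i, k⟩ 1
  obtain ⟨φ, hφ⟩ := hind.exists_algHom_translate (Sum.elim c 0)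
  let N := adjoin K (Set.range (Sum.elim u η))
  have hu : ∀ p, u p ∈ N := fun p ↦ subset_adjoin K _ ⟨.inl p, rfl⟩
  have hηN : adjoin K (Set.range η) ≤ N :=
    adjoin.mono K _ _ (by rintro _ ⟨j, rfl⟩; exact ⟨.inr j, rfl⟩)
  have hφu : ∀ p, φ ⟨u p, hu p⟩ = u p + algebraMap K Ω (c p) :=
    fun p ↦ hφ (.inl p)
  have hφη : ∀ y (hy : y ∈ adjoin K (Set.range η)), φ ⟨y, hηN hy⟩ = y := by
    have : φ.comp (inclusion hηN) = val _ := by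
      refine IntermediateField.algHom_ext_of_eq_adjoin _ rfl ?_
      rintro _ ⟨j, rfl⟩
      exact (hφ (.inr j)).trans (by simp)
    exact fun y hy ↦ DFunLike.congr_fun this ⟨y, hy⟩
  have hζN : ∀ j, ζ j ∈ N := fun j ↦ by
    rw [hζ]
    exact neg_mem (sum_mem fun k _ ↦ mul_mem (hu _) (hηN (ha j k)))
  have hφζ : ∀ j, φ ⟨ζ j, hζN j⟩ =
      -∑ m, (u ⟨j, m⟩ + algebraMap K Ω (c ⟨j, m⟩)) * a j m := by
    intro j
    have : (⟨ζ j, hζN j⟩ : N) =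
        -∑ m, (⟨u ⟨j, m⟩, hu _⟩ : N) * (⟨a j m, hηN (ha j m)⟩ : N) := by
      ext
      simp [hζ]
    rw [this, map_neg, map_sum]
    simp_rw [map_mul, hφu, hφη _ (ha _ _)]
  have hφζi : φ ⟨ζ i, hζN i⟩ = ζ i - a i k := by
    have hc : ∑ m, algebraMap K Ω (c ⟨i, m⟩) * a i m = a i k := by
      rw [Finset.sum_eq_single k]
      · simp [c]
      · intro m _ hm
        simp [c, Pi.single_eq_of_ne (show (⟨i, m⟩ : Σ i, κ i) ≠ ⟨i, k⟩ by simpa using hm)]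
      · simp
    rw [hφζ, hζ]
    simp_rw [add_mul, Finset.sum_add_distrib, hc]
    ring
  have hφζj : ∀ j, j ≠ i → φ ⟨ζ j, hζN j⟩ = ζ j := by
    intro j hj
    rw [hφζ, hζ]
    congr 1
    refine Finset.sum_congr rfl fun m _ ↦ ?_
    simp [c, Pi.single_eq_of_ne
      (show (⟨j, m⟩ : Σ i, κ i) ≠ ⟨i, k⟩ from fun h ↦ hj (congrArg Sigma.fst h))]
  have key : IsAlgebraic (adjoin K S) (φ ⟨ζ i, hζN i⟩) := by
    refine IsAlgebraic.algHom_of_mapsTo_adjoin φ (fun s hs ↦ ?_) halg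
    obtain ⟨p, rfl⟩ | h | ⟨j, hj, rfl⟩ := hS s hs
    · refine ⟨hu p, ?_⟩
      rw [hφu]
      exact add_mem (subset_adjoin K _ (huS ⟨p, rfl⟩)) (IntermediateField.algebraMap_mem _ _)
    · exact ⟨hηN h, by rw [hφη _ h]; exact subset_adjoin K _ hs⟩
    · exact ⟨hζN j, by rw [hφζj j hj]; exact subset_adjoin K _ hs⟩
  rw [hφζi] at key
  simpa using halg.sub key

open IntermediateField in
theorem isAlgebraic_adjoin_adjoin_iff {K Ω : Type*} [Field K] [Field Ω] [Algebra K Ω]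
    {S T : Set Ω} {z : Ω} :
    IsAlgebraic (adjoin (adjoin K S) T) z ↔ IsAlgebraic (adjoin K (S ∪ T)) z := by
  rw [← adjoin_adjoin_left]
  rfl

/-- Exchanging one member of an algebraically independent family. -/
theorem AlgebraicIndependent.of_eq_of_ne {R E Ω : Type*} [Field E] [Field Ω] [Algebra E Ω]
    {f g : R → Ω} (hf : AlgebraicIndependent E f) (s : R) (hfg : ∀ t ≠ s, g t = f t)
    (hs : Transcendental (IntermediateField.adjoin E (f '' {s}ᶜ)) (g s)) :
    AlgebraicIndependent E g := by
  rw [AlgebraicIndependent.iff_transcendental_adjoin_image s] at hf ⊢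
  have him : g '' {s}ᶜ = f '' {s}ᶜ := Set.image_congr fun t ht ↦ hfg t ht
  have hres : (fun j : {j // j ≠ s} ↦ g j) = fun j : {j // j ≠ s} ↦ f j :=
    funext fun j ↦ hfg j j.2
  rw [him, hres, ← IntermediateField.transcendental_adjoin_iff]
  exact ⟨hf.1, hs⟩

open IntermediateField in
/-- Generic linear combinations of rows are algebraically independent over the field of
coefficients iff some choice of one element in each row is. -/
theorem algebraicIndependent_generic_combination_iff {K Ω I H R : Type*} {κ : I → Type*} [Field K]
    [Field Ω] [Algebra K Ω] [∀ i, Fintype (κ i)] [∀ i, Nonempty (κ i)] [Finite R]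
    {u : (Σ i, κ i) → Ω} {η : H → Ω}
    (hind : AlgebraicIndependent K (Sum.elim u η)) {a : (i : I) → κ i → Ω}
    (ha : ∀ i k, a i k ∈ adjoin K (Set.range η)) {ζ : I → Ω}
    (hζ : ∀ i, ζ i = -∑ k, u ⟨i, k⟩ * a i k) (ι : R ↪ I) :
    AlgebraicIndependent (adjoin K (Set.range u)) (fun s ↦ ζ (ι s)) ↔
      ∃ js : (s : R) → κ (ι s),
        AlgebraicIndependent (adjoin K (Set.range u)) fun s ↦ a (ι s) (js s) := by
  classical
  have := Fintype.ofFinite R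
  let mix (T : Finset R) (js : (s : R) → κ (ι s)) (s : R) : Ω :=
    if s ∈ T then ζ (ι s) else a (ι s) (js s)
  suffices h : ∀ T : Finset R,
      (∃ js, AlgebraicIndependent (adjoin K (Set.range u)) (mix T js)) ↔
        ∃ js : (s : R) → κ (ι s),
          AlgebraicIndependent (adjoin K (Set.range u)) fun s ↦ a (ι s) (js s) by
    simpa [mix] using h Finset.univ
  intro T
  induction T using Finset.induction_on with
  | empty => simp [mix]
  | insert s T hsT ih =>
    rw [← ih]
    constructor
    · rintro ⟨js, h⟩
      have hζs : Transcendental (adjoin (adjoin K (Set.range u)) (mix (insert s T) js '' {s}ᶜ))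
          (ζ (ι s)) := by
        have := ((AlgebraicIndependent.iff_transcendental_adjoin_image s).mp h).2
        rw [← IntermediateField.transcendental_adjoin_iff] at this
        simpa [mix] using this
      obtain ⟨k, hk⟩ : ∃ k, Transcendental
          (adjoin (adjoin K (Set.range u)) (mix (insert s T) js '' {s}ᶜ)) (a (ι s) k) := by
        by_contra! hcon
        refine hζs ?_
        rw [hζ, ← mem_algebraicClosure_iff]
        refine neg_mem (sum_mem fun k _ ↦ mul_mem ?_
          (mem_algebraicClosure_iff.mpr (not_not.mp (hcon k))))
        rw [mem_algebraicClosure_iff]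
        exact isAlgebraic_algebraMap (⟨u ⟨_, k⟩, IntermediateField.algebraMap_mem _
          (⟨u ⟨_, k⟩, subset_adjoin K _ ⟨_, rfl⟩⟩ : adjoin K (Set.range u))⟩ :
          adjoin (adjoin K (Set.range u)) (mix (insert s T) js '' {s}ᶜ))
      refine ⟨Function.update js s k, h.of_eq_of_ne s (fun t ht ↦ ?_) ?_⟩
      · simp [mix, ht]
      · simpa [mix, hsT] using hk
    · rintro ⟨js, h⟩
      refine ⟨js, h.of_eq_of_ne s (fun t ht ↦ by simp [mix, ht]) fun halg ↦ ?_⟩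
      have has : Transcendental (adjoin (adjoin K (Set.range u)) (mix T js '' {s}ᶜ))
          (a (ι s) (js s)) := by
        have := ((AlgebraicIndependent.iff_transcendental_adjoin_image s).mp h).2
        rw [← IntermediateField.transcendental_adjoin_iff] at this
        simpa [mix, hsT] using this
      refine has (isAlgebraic_adjoin_adjoin_iff.mpr ?_)
      refine isAlgebraic_of_isAlgebraic_generic_combination hind ha hζ Set.subset_union_left _ ?_
        (isAlgebraic_adjoin_adjoin_iff.mp (by simpa [mix] using halg)) _
      rintro _ (h | ⟨t, ht, rfl⟩)
      · exact .inl h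
      · by_cases htT : t ∈ T
        · exact .inr (.inr ⟨ι t, ι.injective.ne ht, by simp [mix, htT]⟩)
        · exact .inr (.inl (by simpa [mix, htT] using ha _ _))

open IntermediateField in
/-- For families in `K(η)`, adjoining elements that are algebraically independent over `K(η)` to
the base field does not affect algebraic independence. -/
theorem algebraicIndependent_adjoin_iff_of_mem_adjoin {K Ω J H R : Type*} [Field K]
    [Field Ω] [Algebra K Ω] {u : J → Ω} {η : H → Ω}
    (hind : AlgebraicIndependent K (Sum.elim u η)) {f : R → Ω}
    (hf : ∀ s, f s ∈ adjoin K (Set.range η)) :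
    AlgebraicIndependent (adjoin K (Set.range u)) f ↔ AlgebraicIndependent K f := by
  refine ⟨fun h ↦ h.restrictScalars (algebraMap K _).injective, fun h ↦ ?_⟩
  have hu : AlgebraicIndependent (adjoin K (Set.range η)) u :=
    algebraicIndependent_adjoin_iff.mpr (AlgebraicIndependent.sumElim_iff.mp hind).2
  have huf : AlgebraicIndependent K (Sum.elim u f) := h.sumElim_of_tower
    (S := adjoin K (Set.range η)) (by rintro _ ⟨s, rfl⟩; exact ⟨⟨_, hf s⟩, rfl⟩) hu
  have hfu : AlgebraicIndependent K (Sum.elim f u) :=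
    (algebraicIndependent_equiv' (Equiv.sumComm R J) (by ext (_ | _) <;> rfl)).mpr huf
  exact algebraicIndependent_adjoin_iff.mpr (AlgebraicIndependent.sumElim_iff.mp hfu).2

open IntermediateField in
theorem natCast_le_trdeg_adjoin_range_iff {E Ω J : Type*} [Field E] [Field Ω] [Algebra E Ω]
    {ζ : J → Ω} {r : ℕ} :
    (r : Cardinal) ≤ Algebra.trdeg E (adjoin E (Set.range ζ)) ↔
      ∃ ι : Fin r ↪ J, AlgebraicIndependent E fun s ↦ ζ (ι s) := by
  let ξ (j : J) : adjoin E (Set.range ζ) := ⟨ζ j, subset_adjoin E _ ⟨j, rfl⟩⟩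
  constructor
  · intro h
    have htop : adjoin E (Set.range ξ) = ⊤ := by
      apply lift_injective
      rw [lift_adjoin, lift_top, ← Set.range_comp]
      rfl
    have : Algebra.IsAlgebraic (adjoin E (Set.range ξ)) (adjoin E (Set.range ζ)) := by
      rw [htop]
      infer_instance
    have := isAlgebraic_adjoin_iff_top.mp this
    obtain ⟨t, ht, hbasis⟩ := exists_isTranscendenceBasis_subset (R := E) (Set.range ξ)
    rw [← hbasis.cardinalMk_eq_trdeg, ← Cardinal.lift_le.{0}] at h
    obtain ⟨e⟩ : Nonempty (Fin r ↪ t) := by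
      rw [← Cardinal.lift_mk_le']
      simpa using h
    choose p hp using fun s ↦ ht (e s).2
    have hpe : Function.Injective p := fun s s' h ↦ e.injective <| Subtype.ext <| by
      rw [← hp, ← hp, h]
    refine ⟨⟨p, hpe⟩, ?_⟩
    have := (hbasis.1.comp e e.injective).map' (f := (adjoin E (Set.range ζ)).val)
      (adjoin E (Set.range ζ)).val.injective
    convert this using 2 with s
    simp [← hp, ξ]
  · rintro ⟨ι, hι⟩
    have : AlgebraicIndependent E fun s ↦ ξ (ι s) :=
      .of_comp (adjoin E (Set.range ζ)).val hι
    simpa using this.lift_cardinalMk_le_trdeg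

theorem Field.trdeg_add_trdeg.{v} {K : Type*} {E F : Type v} [Field K] [Field E] [Field F]
    [Algebra K E] [Algebra E F] [Algebra K F] [IsScalarTower K E F] :
    Algebra.trdeg K E + Algebra.trdeg E F = Algebra.trdeg K F :=
  trdeg_add_eq K E

open IntermediateField in
theorem trdeg_adjoin_range_union {K Ω J L : Type*} [Field K] [Field Ω] [Algebra K Ω]
    {u : J → Ω} [Fintype J] (hu : AlgebraicIndependent K u) (ζ : L → Ω) :
    Algebra.trdeg K (adjoin K (Set.range u ∪ Set.range ζ)) =
      Fintype.card J +
        Algebra.trdeg (adjoin K (Set.range u)) (adjoin (adjoin K (Set.range u)) (Set.range ζ)) := by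
  have hE : Algebra.trdeg K (adjoin K (Set.range u)) = Fintype.card J := by
    apply le_antisymm
    · by_contra! h
      obtain ⟨ι, -⟩ := natCast_le_trdeg_adjoin_range_iff.mp
        (by simpa using Order.succ_le_of_lt h :
          ((Fintype.card J + 1 : ℕ) : Cardinal) ≤ Algebra.trdeg K (adjoin K (Set.range u)))
      simpa using Fintype.card_le_of_embedding ι
    · exact natCast_le_trdeg_adjoin_range_iff.mpr
        ⟨(Fintype.equivFin J).symm.toEmbedding, hu.comp _ (Fintype.equivFin J).symm.injective⟩
  rw [← hE, Field.trdeg_add_trdeg, ← adjoin_adjoin_left]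
  rfl

open IntermediateField in
theorem AlgebraicIndependent.le_of_mem_adjoin_range {K Ω : Type*} [Field K] [Field Ω]
    [Algebra K Ω] {m n : ℕ} {f : Fin m → Ω} {η : Fin n → Ω} (hf : AlgebraicIndependent K f)
    (hfη : ∀ s, f s ∈ adjoin K (Set.range η)) : m ≤ n := by
  have hf' : AlgebraicIndependent K fun s ↦ (⟨f s, hfη s⟩ : adjoin K (Set.range η)) :=
    .of_comp (val _) hf
  obtain ⟨e, -⟩ := natCast_le_trdeg_adjoin_range_iff.mp
    (by simpa using hf'.lift_cardinalMk_le_trdeg :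
      (m : Cardinal) ≤ Algebra.trdeg K (adjoin K (Set.range η)))
  simpa using Fintype.card_le_of_embedding e

theorem Cardinal.natCast_add_eq_natCast_add_iff_le {t : Cardinal} {N n : ℕ}
    (ht : ¬ ((n + 1 : ℕ) : Cardinal) ≤ t) :
    (N : Cardinal) + t = ((N + n : ℕ) : Cardinal) ↔ (n : Cardinal) ≤ t := by
  obtain ⟨m, rfl⟩ := Cardinal.lt_aleph0.mp ((not_le.mp ht).trans Cardinal.natCast_lt_aleph0)
  norm_cast at ht ⊢
  omega

theorem fieldTrdeg_eq_trdeg (K F : Type*) [Field K] [Field F] [Algebra K F] :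
    fieldTrdeg K F = Algebra.trdeg K F :=
  rfl

/-- **Generic linear combinations.**  Let `u = (u_{ik})` (with `0 ≤ i ≤ n`,
`1 ≤ k ≤ l_i`) and `η₁,…,ηₙ` be jointly algebraically independent over `K` in an
extension `Ω`, let `a_{ik}` be nonzero elements of `K(η₁,…,ηₙ)`, and set
`ζ_i = -∑_k u_{ik} a_{ik}`.  Then for every `r`:
`trdeg K(u)(ζ₀,…,ζₙ)/K(u) ≥ r` iff there exist distinct indices `i₁,…,i_r` and
choices `j₁,…,j_r` with `a_{i₁j₁},…,a_{i_rj_r}` algebraically independent over `K`.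
In particular, `trdeg K(u,ζ₀,…,ζₙ)/K = ∑ l_i + n` iff there exist such pairs with
`r = n`. -/
theorem stmt16 (K Ω : Type*) [Field K] [Field Ω] [Algebra K Ω]
    (n : ℕ) (l : Fin (n + 1) → ℕ) (hl : ∀ i, 1 ≤ l i)
    (u : ((i : Fin (n + 1)) × Fin (l i)) → Ω) (η : Fin n → Ω)
    (hind : AlgebraicIndependent K
      (Sum.elim u η : ((i : Fin (n + 1)) × Fin (l i)) ⊕ Fin n → Ω))
    (a : (i : Fin (n + 1)) → Fin (l i) → Ω)
    (ha : ∀ i k, a i k ≠ 0 ∧ a i k ∈ IntermediateField.adjoin K (Set.range η))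
    (ζ : Fin (n + 1) → Ω)
    (hζ : ∀ i, ζ i = -∑ k : Fin (l i), u ⟨i, k⟩ * a i k) :
    (∀ r : ℕ,
      ((r : Cardinal) ≤
        fieldTrdeg (↥(IntermediateField.adjoin K (Set.range u)))
          (↥(IntermediateField.adjoin (↥(IntermediateField.adjoin K (Set.range u)))
              (Set.range ζ)))
        ↔ ∃ (ι : Fin r ↪ Fin (n + 1)) (js : (s : Fin r) → Fin (l (ι s))),
            AlgebraicIndependent K (fun s => a (ι s) (js s))))
    ∧ (fieldTrdeg K (↥(IntermediateField.adjoin K (Set.range u ∪ Set.range ζ)))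
        = (((∑ i, l i) + n : ℕ) : Cardinal)
      ↔ ∃ (ι : Fin n ↪ Fin (n + 1)) (js : (s : Fin n) → Fin (l (ι s))),
          AlgebraicIndependent K (fun s => a (ι s) (js s))) := by
  have : ∀ i, Nonempty (Fin (l i)) := fun i ↦ ⟨⟨0, hl i⟩⟩
  have haη : ∀ i k, a i k ∈ IntermediateField.adjoin K (Set.range η) := fun i k ↦ (ha i k).2
  have hu : AlgebraicIndependent K u := by
    simpa [Function.comp_def] using hind.comp Sum.inl Sum.inl_injective
  simp only [fieldTrdeg_eq_trdeg]
  have hrank (r : ℕ) := (natCast_le_trdeg_adjoin_range_iff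
      (E := IntermediateField.adjoin K (Set.range u)) (ζ := ζ) (r := r)).trans <|
    exists_congr fun ι ↦
      (algebraicIndependent_generic_combination_iff hind haη hζ ι).trans <| exists_congr fun js ↦
        algebraicIndependent_adjoin_iff_of_mem_adjoin hind fun s ↦ haη (ι s) (js s)
  refine ⟨hrank, ?_⟩
  rw [← hrank n, trdeg_adjoin_range_union hu, Fintype.card_sigma]
  simp only [Fintype.card_fin]
  refine Cardinal.natCast_add_eq_natCast_add_iff_le fun h ↦ ?_
  obtain ⟨ι, js, hjs⟩ := (hrank (n + 1)).mp h
  exact absurd (hjs.le_of_mem_adjoin_range fun s ↦ haη _ _) (by simp)
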